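/- r̃(C4, P7) = 13: Builder can force within 13 rounds a red copy of C4 or a blue copy of the path P7 on 7 vertices, and moreover for every Builder strategy there exists a Painter strategy such that after 12 rounds the red edges contain no copy of C4 and the blue edges contain no path on 7 vertices. -/

import Mathlib

/-!
The online size Ramsey game on `K_ℕ`: in each round Builder selects a previously
unselected edge and Painter colours it red (`true`) or blue (`false`).
-/

namespace OnlineRamsey

abbrev Edge := Sym2 ℕ
abbrev History := List (Edge × Bool)   -- `true` = red, `false` = blue
abbrev BuilderStrat := History → Edge
abbrev PainterStrat := History → Edge → Bool

/-- The history of the game after `t` rounds, when Builder follows `B` and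
Painter follows `P`. -/
def gamePlay (B : BuilderStrat) (P : PainterStrat) : ℕ → History
  | 0 => []
  | t + 1 =>
      let h := gamePlay B P t
      h ++ [(B h, P h (B h))]

def redSet (h : History) : Set Edge := {e | (e, true) ∈ h}
def blueSet (h : History) : Set Edge := {e | (e, false) ∈ h}
def chosenSet (h : History) : Set Edge := {e | ∃ c, (e, c) ∈ h}

def redGraph (h : History) : SimpleGraph ℕ := SimpleGraph.fromEdgeSet (redSet h)
def blueGraph (h : History) : SimpleGraph ℕ := SimpleGraph.fromEdgeSet (blueSet h)

/-- `H` contains a copy of `G`. -/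
def HasCopy {α β : Type} (G : SimpleGraph α) (H : SimpleGraph β) : Prop :=
  ∃ f : G →g H, Function.Injective f

/-- During the first `m` rounds Builder always selects a previously unselected
(non-loop) edge, whatever Painter does. -/
def BuilderLegal (B : BuilderStrat) (m : ℕ) : Prop :=
  ∀ P : PainterStrat, ∀ t < m,
    ¬ (B (gamePlay B P t)).IsDiag ∧ B (gamePlay B P t) ∉ chosenSet (gamePlay B P t)

/-- Builder can force, within `m` rounds, the red graph to contain a copy of `G`
or the blue graph to contain a copy of `H`. -/
def BuilderForces {α β : Type} (G : SimpleGraph α) (H : SimpleGraph β) (m : ℕ) : Prop :=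
  ∃ B : BuilderStrat, BuilderLegal B m ∧
    ∀ P : PainterStrat, ∃ t ≤ m,
      HasCopy G (redGraph (gamePlay B P t)) ∨ HasCopy H (blueGraph (gamePlay B P t))

/-! ### Winning positions and Builder's strategy -/

abbrev C4 : SimpleGraph (Fin 4) := SimpleGraph.cycleGraph 4
abbrev P7 : SimpleGraph (Fin 7) := SimpleGraph.pathGraph 7

def Target (h : History) : Prop :=
  HasCopy C4 (redGraph h) ∨ HasCopy P7 (blueGraph h)

/-- Builder, to move after history `h`, can reach the target within `m` more rounds. -/
def Win : ℕ → History → Prop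
  | 0, h => Target h
  | m + 1, h => Target h ∨ ∃ e : Edge, (¬ e.IsDiag ∧ e ∉ chosenSet h) ∧
      Win m (h ++ [(e, true)]) ∧ Win m (h ++ [(e, false)])

lemma HasCopy.mono {α β : Type} {G : SimpleGraph α} {H K : SimpleGraph β} (hle : H ≤ K)
    (h : HasCopy G H) : HasCopy G K := by
  obtain ⟨f, hf⟩ := h
  exact ⟨⟨f, fun hab => hle (f.map_rel hab)⟩, hf⟩

lemma Target.mono {h : History} (x : Edge × Bool) (ht : Target h) : Target (h ++ [x]) := by
  rcases ht with ht | ht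
  · refine Or.inl (ht.mono (SimpleGraph.fromEdgeSet_mono ?_))
    intro e he
    exact List.mem_append_left _ he
  · refine Or.inr (ht.mono (SimpleGraph.fromEdgeSet_mono ?_))
    intro e he
    exact List.mem_append_left _ he

lemma Target.win {h : History} (ht : Target h) (m : ℕ) : Win m h := by
  cases m with
  | zero => exact ht
  | succ m => exact Or.inl ht

lemma exists_fresh (h : History) : ∃ e : Edge, ¬ e.IsDiag ∧ e ∉ chosenSet h := by
  have hfin : (chosenSet h).Finite := by
    refine (List.finite_toSet (h.map Prod.fst)).subset ?_
    rintro e ⟨c, hc⟩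
    exact List.mem_map.2 ⟨_, hc, rfl⟩
  have hinj : Function.Injective (fun n : ℕ => (s(0, n + 1) : Edge)) := by
    intro a b hab
    simp at hab
    omega
  obtain ⟨e, ⟨n, rfl⟩, he⟩ := ((Set.infinite_range_of_injective hinj).sdiff hfin).nonempty
  exact ⟨_, by simp, he⟩

lemma gamePlay_length (B : BuilderStrat) (P : PainterStrat) (t : ℕ) :
    (gamePlay B P t).length = t := by
  induction t with
  | zero => rfl
  | succ t ih => simp [gamePlay, ih]

lemma forces_of_win (M : ℕ) (hw : Win M []) : BuilderForces C4 P7 M := by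
  classical
  have key : ∀ h : History, ∃ e : Edge, (¬ e.IsDiag ∧ e ∉ chosenSet h) ∧
      ((∃ e' : Edge, (¬ e'.IsDiag ∧ e' ∉ chosenSet h) ∧
        Win (M - h.length - 1) (h ++ [(e', true)]) ∧
        Win (M - h.length - 1) (h ++ [(e', false)])) →
        Win (M - h.length - 1) (h ++ [(e, true)]) ∧
        Win (M - h.length - 1) (h ++ [(e, false)])) := by
    intro h
    by_cases hh : ∃ e' : Edge, (¬ e'.IsDiag ∧ e' ∉ chosenSet h) ∧
        Win (M - h.length - 1) (h ++ [(e', true)]) ∧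
        Win (M - h.length - 1) (h ++ [(e', false)])
    · obtain ⟨e, he, hw⟩ := hh
      exact ⟨e, he, fun _ => hw⟩
    · obtain ⟨e, he⟩ := exists_fresh h
      exact ⟨e, he, fun h' => absurd h' hh⟩
  choose B hB hB2 using key
  refine ⟨B, fun P t _ => hB _, fun P => ⟨M, le_rfl, ?_⟩⟩
  have inv : ∀ t ≤ M, Win (M - t) (gamePlay B P t) := by
    intro t
    induction t with
    | zero => intro _; exact hw
    | succ t ih =>
      intro ht
      have h1 := ih (by omega)
      obtain ⟨k, hk⟩ : ∃ k, M - t = k + 1 := ⟨M - t - 1, by omega⟩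
      have hk2 : M - (t + 1) = k := by omega
      rw [hk] at h1
      rw [hk2]
      rcases h1 with h1 | h1
      · exact (h1.mono _).win _
      · have h2 := hB2 (gamePlay B P t)
        rw [gamePlay_length, hk, Nat.add_sub_cancel] at h2
        have h3 := h2 h1
        show Win k (gamePlay B P t ++ [(B (gamePlay B P t), P _ (B (gamePlay B P t)))])
        cases P (gamePlay B P t) (B (gamePlay B P t))
        · exact h3.2
        · exact h3.1
  have := inv M le_rfl
  rw [Nat.sub_self] at this
  exact this

/-! ### A checker for an explicit strategy

Tokens, in preorder (red answer before blue answer): `10 u + v` is the move `uv`;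
`1abcd` asserts a red `C₄` on `a, b, c, d`; `1abcdefg` asserts a blue path. -/

def mem (l : List (ℕ × ℕ)) (a b : ℕ) : Bool :=
  l.any fun p => (Nat.beq p.1 a && Nat.beq p.2 b) || (Nat.beq p.1 b && Nat.beq p.2 a)

def nodupB : List ℕ → Bool
  | [] => true
  | a :: l => l.all (fun b => !(Nat.beq a b)) && nodupB l

def isC4 (r : List (ℕ × ℕ)) (a b c d : ℕ) : Bool :=
  nodupB [a, b, c, d] && mem r a b && mem r b c && mem r c d && mem r d a

def isP7 (l : List (ℕ × ℕ)) (a b c d e f g : ℕ) : Bool :=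
  nodupB [a, b, c, d, e, f, g] && mem l a b && mem l b c && mem l c d && mem l d e &&
    mem l e f && mem l f g

def leafOK (t : ℕ) (r b : List (ℕ × ℕ)) : Bool :=
  isC4 r (t / 1000 % 10) (t / 100 % 10) (t / 10 % 10) (t % 10) ||
  isP7 b (t / 1000000 % 10) (t / 100000 % 10) (t / 10000 % 10) (t / 1000 % 10)
    (t / 100 % 10) (t / 10 % 10) (t % 10)

def run : ℕ → List ℕ → List (ℕ × ℕ) → List (ℕ × ℕ) → Option (List ℕ)
  | _, [], _, _ => none
  | 0, t :: ts, r, b => bif leafOK t r b then some ts else none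
  | m + 1, t :: ts, r, b =>
    bif Nat.ble 100 t then
      (bif leafOK t r b then some ts else none)
    else
      bif Nat.beq (t / 10) (t % 10) || mem r (t / 10) (t % 10) || mem b (t / 10) (t % 10) then none
      else
        match run m ts ((t / 10, t % 10) :: r) b with
        | none => none
        | some ts' => run m ts' r ((t / 10, t % 10) :: b)

lemma mem_iff (l : List (ℕ × ℕ)) (a b : ℕ) :
    mem l a b = true ↔ ∃ p ∈ l, (s(p.1, p.2) : Edge) = s(a, b) := by
  simp [mem, List.any_eq_true]

lemma beq_false {a b : ℕ} (h : a ≠ b) : Nat.beq a b = false := by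
  rw [Bool.eq_false_iff]
  exact fun h' => h (Nat.eq_of_beq_eq_true h')

lemma nodupB_iff (l : List ℕ) : nodupB l = true ↔ l.Nodup := by
  induction l with
  | nil => simp [nodupB]
  | cons a l ih =>
    simp only [nodupB, Bool.and_eq_true, ih, List.nodup_cons, List.all_eq_true]
    refine and_congr_left fun _ => ⟨fun h ha => ?_, fun h b hb => ?_⟩
    · simpa using h a ha
    · have hab : a ≠ b := fun hab => h (hab ▸ hb)
      rw [beq_false hab]
      rfl

/-- The lists `r`, `b` record the red and blue edges of `h`. -/
structure Rep (h : History) (r b : List (ℕ × ℕ)) : Prop where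
  red : ∀ u v, mem r u v = true ↔ (s(u, v), true) ∈ h
  blue : ∀ u v, mem b u v = true ↔ (s(u, v), false) ∈ h

lemma hasCopy_C4_of (h : History) (a b c d : ℕ) (hn : [a, b, c, d].Nodup)
    (h1 : (s(a, b), true) ∈ h) (h2 : (s(b, c), true) ∈ h) (h3 : (s(c, d), true) ∈ h)
    (h4 : (s(d, a), true) ∈ h) : HasCopy C4 (redGraph h) := by
  have hinj : Function.Injective ![a, b, c, d] := by
    have := List.nodup_iff_injective_get.1 hn
    intro i j hij
    fin_cases i <;> fin_cases j <;> simp_all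
  have hc : ∀ i j : Fin 4, C4.Adj i j → j = i + 1 ∨ i = j + 1 := by decide
  have hs : ∀ i : Fin 4, (redGraph h).Adj (![a, b, c, d] i) (![a, b, c, d] (i + 1)) := by
    intro i
    refine (SimpleGraph.fromEdgeSet_adj _).2 ⟨?_, fun he => ?_⟩
    · fin_cases i
      exacts [h1, h2, h3, h4]
    · have hne : ∀ i : Fin 4, i ≠ i + 1 := by decide
      exact hne i (hinj he)
  refine ⟨⟨![a, b, c, d], ?_⟩, hinj⟩
  intro i j hij
  rcases hc i j hij with rfl | rfl
  · exact hs i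
  · exact (hs j).symm

lemma hasCopy_P7_of (h : History) (a b c d e f g : ℕ) (hn : [a, b, c, d, e, f, g].Nodup)
    (h1 : (s(a, b), false) ∈ h) (h2 : (s(b, c), false) ∈ h) (h3 : (s(c, d), false) ∈ h)
    (h4 : (s(d, e), false) ∈ h) (h5 : (s(e, f), false) ∈ h) (h6 : (s(f, g), false) ∈ h) :
    HasCopy P7 (blueGraph h) := by
  have hinj : Function.Injective ![a, b, c, d, e, f, g] := by
    have := List.nodup_iff_injective_get.1 hn
    intro i j hij
    exact this (a₁ := i) (a₂ := j) (by
      revert hij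
      fin_cases i <;> fin_cases j <;> exact id)
  have hs : ∀ i j : Fin 7, i.val + 1 = j.val →
      (blueGraph h).Adj (![a, b, c, d, e, f, g] i) (![a, b, c, d, e, f, g] j) := by
    intro i j hij
    refine (SimpleGraph.fromEdgeSet_adj _).2 ⟨?_, fun he => ?_⟩
    · fin_cases i <;> fin_cases j <;> first | (exfalso; revert hij; decide) | assumption
    · have := hinj he
      subst this
      omega
  refine ⟨⟨![a, b, c, d, e, f, g], ?_⟩, hinj⟩
  intro i j hij
  rcases SimpleGraph.pathGraph_adj.1 hij with hij | hij
  · exact hs i j hij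
  · exact (hs j i hij).symm

lemma leafOK_target {t : ℕ} {h : History} {r b : List (ℕ × ℕ)} (hr : Rep h r b)
    (hl : leafOK t r b = true) : Target h := by
  rw [leafOK, Bool.or_eq_true] at hl
  rcases hl with hl | hl
  · simp only [isC4, Bool.and_eq_true, nodupB_iff, hr.red] at hl
    obtain ⟨⟨⟨⟨hn, h1⟩, h2⟩, h3⟩, h4⟩ := hl
    exact Or.inl (hasCopy_C4_of h _ _ _ _ hn h1 h2 h3 h4)
  · simp only [isP7, Bool.and_eq_true, nodupB_iff, hr.blue] at hl
    obtain ⟨⟨⟨⟨⟨⟨hn, h1⟩, h2⟩, h3⟩, h4⟩, h5⟩, h6⟩ := hl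
    exact Or.inr (hasCopy_P7_of h _ _ _ _ _ _ _ hn h1 h2 h3 h4 h5 h6)

lemma mem_cons_iff (l : List (ℕ × ℕ)) (x y u v : ℕ) :
    mem ((x, y) :: l) u v = true ↔ mem l u v = true ∨ (s(u, v) : Edge) = s(x, y) := by
  rw [mem_iff, mem_iff]
  simp only [List.mem_cons, exists_eq_or_imp]
  rw [or_comm, eq_comm (a := (s(u, v) : Edge))]

lemma Rep.addRed {h : History} {r b : List (ℕ × ℕ)} (hr : Rep h r b) (x y : ℕ) :
    Rep (h ++ [(s(x, y), true)]) ((x, y) :: r) b where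
  red u v := by rw [mem_cons_iff, hr.red]; simp
  blue u v := by rw [hr.blue]; simp

lemma Rep.addBlue {h : History} {r b : List (ℕ × ℕ)} (hr : Rep h r b) (x y : ℕ) :
    Rep (h ++ [(s(x, y), false)]) r ((x, y) :: b) where
  red u v := by rw [hr.red]; simp
  blue u v := by rw [mem_cons_iff, hr.blue]; simp

lemma run_sound (m : ℕ) : ∀ (ts : List ℕ) (h : History) (r b : List (ℕ × ℕ)) (rest : List ℕ),
    Rep h r b → run m ts r b = some rest → Win m h := by
  induction m with
  | zero =>
    intro ts h r b rest hr hrun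
    cases ts with
    | nil => simp [run] at hrun
    | cons t ts =>
      rw [run] at hrun
      cases hl : leafOK t r b with
      | true => exact leafOK_target hr hl
      | false => simp [hl] at hrun
  | succ m ih =>
    intro ts h r b rest hr hrun
    cases ts with
    | nil => simp [run] at hrun
    | cons t ts =>
      rw [run] at hrun
      cases h100 : Nat.ble 100 t with
      | true =>
        rw [h100, cond_true] at hrun
        cases hl : leafOK t r b with
        | true => exact (leafOK_target hr hl).win _
        | false => simp [hl] at hrun
      | false =>
        rw [h100, cond_false] at hrun
        cases hc : (Nat.beq (t / 10) (t % 10) || mem r (t / 10) (t % 10) ||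
            mem b (t / 10) (t % 10)) with
        | true => simp [hc] at hrun
        | false =>
          rw [hc, cond_false] at hrun
          simp only [Bool.or_eq_false_iff] at hc
          obtain ⟨⟨hne, hmr⟩, hmb⟩ := hc
          cases hR : run m ts ((t / 10, t % 10) :: r) b with
          | none => simp [hR] at hrun
          | some ts' =>
            simp only [hR] at hrun
            refine Or.inr ⟨s(t / 10, t % 10), ⟨?_, ?_⟩, ih _ _ _ _ _ (hr.addRed _ _) hR,
              ih _ _ _ _ _ (hr.addBlue _ _) hrun⟩
            · rw [Sym2.mk_isDiag_iff]
              exact Nat.ne_of_beq_eq_false hne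
            · rintro ⟨c, hcm⟩
              cases c with
              | true => rw [← hr.red, hmr] at hcm; exact Bool.noConfusion hcm
              | false => rw [← hr.blue, hmb] at hcm; exact Bool.noConfusion hcm

/-- Builder's strategy, in the format read by `run`. -/
def strategy : List ℕ :=
  [1, 2, 13, 23, 10132, 4, 34, 10134, 15, 25, 10152, 6, 56, 10156, 47, 17, 10174, 67, 10476,
   11765234, 12, 16, 10216, 11652347, 36, 10136, 11256347, 45, 10154, 3, 5, 10315, 12, 10213,
   11234506, 12, 14, 10214, 11452306, 11254306, 26, 46, 10264, 16, 10162, 5, 27, 57, 10275,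
   12346157, 15164327, 10516432, 5, 35, 10135, 17, 27, 10172, 47, 10174, 11534726, 24, 45, 10245,
   16234517, 16243517, 6, 14, 16, 10416, 10516234, 10514326, 11506234, 15, 25, 10152, 36, 56,
   11365, 6, 10136, 14, 37, 47, 11374, 13256047, 14065237, 11406523, 6, 56, 10156, 3, 5, 10315,
   12, 10213, 11236504, 12, 16, 10216, 11652304, 11256304, 14, 57, 47, 11475, 15236047, 14063257,
   11406325, 6, 36, 10136, 24, 14, 10142, 25, 56, 10256, 10415632, 10415236, 5, 16, 56, 10165,
   10423651, 10423615, 11504236, 14, 24, 10142, 56, 16, 35, 11356, 11532406, 13240615, 11560423,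
   25, 36, 26, 35, 12536, 12351406, 13260415, 12360415, 13251406, 24, 14, 10142, 5, 45, 10245, 3,
   36, 26, 10263, 56, 10365, 27, 37, 10273, 12654137, 13145627, 27, 57, 10275, 4, 7, 10427,
   10754136, 17, 10172, 10457136, 57, 12, 25, 10125, 16314527, 37, 10375, 15412736, 12754136, 26,
   56, 10265, 67, 7, 10267, 16541307, 10314567, 6, 25, 56, 10256, 10314562, 10314526, 12603145,
   23, 36, 46, 12364, 6, 10236, 25, 37, 57, 12375, 13146057, 15064137, 12506413, 6, 46, 10246, 3,
   4, 10324, 12, 10123, 12136405, 12, 26, 10126, 12641305, 12146305, 25, 57, 47, 12475, 15063147,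
   14136057, 12506314, 6, 46, 10246, 56, 25, 10256, 10523146, 10564132, 25, 46, 45, 26, 12546,
   14132605, 12314506, 12314605, 14132506, 15, 25, 10152, 3, 35, 10153, 6, 56, 10156, 17, 27,
   10172, 67, 10176, 11356724, 26, 36, 10263, 14256317, 14265317, 4, 16, 46, 10164, 10642531,
   10613524, 11352406, 6, 56, 10156, 4, 14, 16, 10416, 10316524, 10314256, 11304256, 14, 46, 56,
   11465, 11306524, 11306425, 15241306, 3, 4, 26, 46, 10264, 36, 10263, 5, 27, 57, 10275,
   12463157, 15136427, 10513642, 36, 5, 56, 10365, 37, 47, 10374, 13156247, 14265137, 6, 34,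
   10436, 10513426, 13150624, 5, 57, 47, 10475, 15136247, 14263157, 10513624, 26, 36, 10263, 16,
   10162, 6, 23, 10326, 10423615, 12406315, 56, 36, 5, 10365, 13150426, 10426315, 10426513, 4, 26,
   46, 10264, 56, 6, 25, 10256, 10315246, 12460315, 10315642, 6, 45, 56, 10456, 10315624,
   10315426, 14260315, 26, 56, 57, 27, 12657, 15130427, 12403157, 12403156, 15130426, 13, 14, 5,
   35, 10135, 45, 10145, 36, 46, 11364, 6, 10136, 12, 27, 37, 11273, 12064537, 13546027, 11206453,
   6, 46, 10146, 3, 4, 10314, 15, 10315, 11536402, 15, 16, 10516, 11645302, 11546302, 12, 27, 47,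
   11274, 12063547, 14536027, 11206354, 23, 24, 11324, 15, 46, 36, 11364, 56, 11465, 37, 47,
   11374, 13650247, 14205637, 37, 57, 11375, 12, 17, 11237, 11750246, 47, 11374, 11205746, 57, 7,
   10157, 25, 11325, 13705246, 13750246, 36, 46, 11364, 17, 67, 11367, 11502467, 16420517, 46, 16,
   34, 11346, 11502436, 13615024, 11502463, 15, 36, 56, 11365, 46, 11364, 47, 37, 11374, 14650237,
   13205647, 47, 57, 11475, 7, 10147, 17, 45, 11547, 14570236, 11750236, 57, 46, 67, 45, 14576,
   16320547, 14763205, 15023647, 14750236, 46, 36, 11364, 17, 67, 11467, 11502367, 16320517, 16,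
   34, 36, 11436, 11502364, 11502346, 13205164, 5, 35, 10135, 6, 36, 10136, 25, 12, 10125, 45, 46,
   10546, 10214635, 10214536, 4, 16, 46, 10164, 10253641, 10253614, 11402536, 12, 25, 10125, 46,
   16, 34, 11346, 11435206, 13520614, 11460253, 34, 36, 56, 45, 13456, 13541206, 13560214,
   14120635, 15341206, 23, 15, 25, 11325, 36, 6, 10136, 67, 17, 11367, 27, 12367, 14172506, 4, 45,
   10154, 11452067, 56, 11365, 11402567, 3, 12, 10123, 35, 10153, 14120536, 46, 16, 45, 11546,
   11452036, 12503614, 11463025, 34, 26, 46, 12346, 16, 11326, 27, 47, 12347, 12051647, 14615027,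
   36, 67, 47, 13476, 16205147, 14150267, 13620514, 26, 37, 67, 12376, 7, 10137, 13415076,
   12051437, 13415026, 15, 36, 56, 11365, 6, 10136, 34, 45, 11345, 11456023, 11432056, 16, 45, 46,
   11546, 11463205, 11450236, 14163205, 36, 46, 37, 47, 13647, 13205147, 14150237, 13205146,
   14150236, 45, 4, 15, 10154, 24, 6, 26, 10426, 56, 10456, 34, 7, 37, 10437, 10265137, 13156207,
   10265134, 12, 10124, 23, 35, 12354, 27, 57, 12457, 16021357, 3, 10324, 16035127, 46, 57, 67,
   14576, 15132067, 16023157, 14602315, 6, 56, 10456, 3, 34, 46, 10346, 10246513, 10243156,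
   14203156, 56, 36, 34, 13456, 15134206, 14206315, 13156024, 14, 5, 10145, 12, 25, 11254, 16, 56,
   11456, 34, 36, 11436, 11365204, 11340256, 23, 34, 11234, 12504316, 14052316, 24, 26, 56, 12456,
   34, 36, 12436, 12136504, 12134056, 35, 15, 34, 11435, 15043126, 23, 12354, 14051326, 14053126,
   36, 56, 16, 11456, 34, 13456, 15024316, 13124056, 15042136, 25, 35, 26, 36, 12536, 67, 27, 56,
   12567, 12041365, 16314027, 12041367, 56, 67, 37, 13567, 16204137, 13140267, 13140265, 26, 46,
   12546, 5, 6, 10526, 12064135, 12053146, 15314026, 36, 56, 57, 37, 13657, 15204137, 13140257,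
   13140256, 15204136, 24, 4, 12, 10124, 5, 46, 56, 10465, 36, 6, 34, 10436, 10213456, 13120654,
   10213654, 6, 35, 36, 10536, 10213645, 10213546, 13120645, 36, 46, 16, 10164, 23, 12364,
   14502316, 13120546, 14502136, 12, 15, 26, 56, 11265, 6, 10126, 14, 16, 11426, 12045613,
   12065413, 36, 16, 35, 11536, 11354026, 13162045, 11362045, 26, 36, 37, 27, 12637, 13154027,
   12045137, 12045136, 13154026, 36, 56, 37, 57, 13657, 13120457, 15402137, 13120456, 15402136, 3,
   16, 36, 10163, 56, 6, 15, 10156, 10245136, 11360245, 10245631, 6, 35, 56, 10356, 10245613,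
   10245316, 13160245, 16, 56, 57, 17, 11657, 15420317, 11302457, 11302456, 15420316, 2, 23, 24,
   5, 35, 10235, 45, 10245, 36, 46, 12364, 6, 10236, 12, 17, 37, 11237, 11064537, 13546017,
   12106453, 6, 46, 10246, 3, 4, 10324, 25, 10325, 11046352, 25, 26, 10526, 11035462, 11036452,
   12, 17, 47, 11247, 11063547, 14536017, 12106354, 13, 14, 11324, 25, 46, 36, 12364, 56, 12465,
   37, 47, 12374, 13650147, 14105637, 37, 57, 12375, 12, 27, 11273, 12750146, 47, 12374, 12105746,
   57, 7, 10257, 15, 11325, 13705146, 13750146, 36, 46, 12364, 67, 27, 12367, 16410527, 12501467,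
   46, 26, 34, 12346, 12501436, 13625014, 12501463, 25, 36, 56, 12365, 46, 12364, 47, 37, 12374,
   14650137, 13105647, 47, 57, 12475, 7, 10247, 27, 45, 12547, 14570136, 12750136, 57, 46, 7,
   10257, 56, 12465, 11365074, 15013647, 14750136, 46, 36, 12364, 67, 27, 12467, 16310527,
   12501367, 26, 34, 36, 12436, 12501364, 12501346, 13105264, 5, 35, 10235, 6, 36, 10236, 15, 12,
   10215, 45, 46, 10546, 10124635, 10124536, 4, 26, 46, 10264, 10153642, 10153624, 12401536, 12,
   15, 10215, 46, 26, 34, 12346, 12435106, 13510624, 12460153, 34, 36, 56, 45, 13456, 13542106,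
   13560124, 14210635, 15342106, 13, 25, 15, 11325, 36, 6, 10236, 67, 17, 11367, 27, 12367,
   14271506, 4, 45, 10254, 12451067, 56, 12365, 12401567, 3, 12, 10213, 35, 10253, 14210536, 46,
   26, 45, 12546, 12451036, 11503624, 11503642, 34, 16, 46, 11346, 26, 11326, 17, 47, 11347,
   11052647, 14625017, 36, 67, 47, 13476, 16105247, 14250167, 13610524, 16, 37, 67, 11376, 7,
   10237, 13425076, 11052437, 13425016, 25, 36, 56, 12365, 6, 10236, 34, 45, 12345, 12456013,
   12431056, 26, 45, 46, 12546, 12463105, 12450136, 14263105, 36, 46, 37, 47, 13647, 13105247,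
   14250137, 13105246, 14250136, 45, 3, 46, 4, 25, 10254, 26, 10264, 35, 10354, 67, 7, 10467, 57,
   14576, 11075326, 12, 13, 10213, 10135267, 36, 10364, 10125367, 25, 26, 12546, 35, 10253, 15,
   16, 11546, 14016235, 14015326, 36, 26, 10263, 35, 13546, 15, 16, 11546, 13526104, 14015326, 15,
   16, 11546, 14016325, 14015236, 25, 35, 10253, 4, 10254, 56, 6, 10256, 24, 26, 12456, 11046235,
   11064235, 11046532, 5, 34, 10345, 6, 15, 16, 10516, 10164325, 10152346, 11064325, 36, 14, 34,
   16, 11436, 13250164, 11052346, 13250146, 11052364, 14, 25, 4, 10254, 12, 11254, 56, 16, 11456,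
   47, 67, 14567, 14032167, 16123047, 16, 15, 46, 11546, 11230465, 14032156, 14032165, 16, 56,
   11456, 67, 46, 17, 11467, 16523017, 11032564, 11032567, 46, 67, 57, 14576, 16103257, 15230167,
   14610325, 26, 56, 5, 10265, 24, 12456, 16, 17, 57, 11657, 11423057, 15032417, 15032416, 46, 25,
   12546, 14103256, 12301465, 56, 67, 47, 14567, 16230147, 14103267, 14103265, 14, 4, 12, 10214,
   5, 46, 56, 10465, 36, 6, 34, 10436, 10123456, 13210654, 10123654, 6, 35, 36, 10536, 10123645,
   10123546, 13210645, 36, 46, 13, 11364, 26, 10264, 14501326, 13210546, 14501236, 12, 13, 26, 36,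
   11263, 25, 16, 56, 11256, 11045632, 12361045, 11045236, 16, 35, 56, 11356, 11045623, 11045326,
   13261045, 26, 46, 11264, 5, 56, 10265, 12310456, 12310546, 15401326, 36, 56, 37, 57, 13657,
   13210457, 15401237, 13210456, 15401236, 3, 26, 36, 10263, 56, 25, 6, 10256, 12360145, 10145236,
   10145632, 6, 35, 56, 10356, 10145623, 10145326, 13260145, 26, 56, 57, 27, 12657, 15410327,
   12301457, 12301456, 15410326, 34, 15, 36, 45, 56, 13456, 13, 11345, 24, 26, 12436, 57, 37,
   13457, 15620137, 13102657, 46, 35, 13546, 14201356, 13102465, 13, 56, 11365, 47, 67, 13476, 17,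
   11347, 12017654, 27, 17, 16, 26, 11627, 11026547, 12016547, 12017456, 11027456, 24, 26, 12436,
   56, 35, 46, 13465, 13102645, 14531026, 13102654, 56, 37, 57, 13657, 13102457, 15420137,
   13102456, 56, 46, 35, 13465, 14, 11465, 26, 45, 25, 12546, 14102536, 12014536, 14102635, 35,
   14, 11435, 25, 27, 37, 12537, 12014637, 13641027, 13641025, 14, 24, 25, 11425, 11025364,
   11024635, 12014635, 13, 45, 11345, 24, 14, 23, 11324, 11023654, 12014563, 11024563, 45, 24, 57,
   27, 12457, 15631027, 12013657, 14201365, 12013654, 26, 23, 46, 12346, 35, 56, 12356, 47, 27,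
   12347, 14651027, 12015647, 24, 36, 12436, 12015364, 13510246, 56, 45, 36, 13456, 24, 12456, 4,
   6, 10456, 14236015, 15104236, 36, 47, 46, 37, 13647, 14510237, 13201546, 13201547, 14510236,
   46, 67, 37, 13467, 16510237, 13201567, 13201564, 35, 47, 57, 13475, 46, 37, 36, 13647,
   13620157, 13751026, 14620157, 67, 57, 46, 45, 14576, 16201547, 15102647, 14751026, 14762015,
   46, 37, 67, 13467, 13510267, 16201537, 13510264, 13, 15, 14, 36, 56, 11365, 46, 11364, 23, 25,
   11325, 11025643, 11023465, 56, 46, 11465, 23, 24, 11324, 17, 67, 11567, 11024367, 13642017, 67,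
   17, 11567, 14632017, 11023467, 25, 24, 11425, 11024365, 11025634, 36, 56, 11365, 26, 35, 25,
   12536, 13410256, 12014356, 13410265, 56, 25, 67, 27, 12567, 16341027, 12014367, 15201436,
   12014365, 45, 24, 26, 56, 12456, 36, 46, 23, 12364, 14320156, 12015643, 12015634, 46, 36, 35,
   13546, 14351026, 14362015, 13462015, 36, 56, 37, 57, 13657, 13420157, 15102437, 13420156,
   15102436, 26, 36, 27, 37, 12637, 12015437, 13451027, 12015436, 13451026, 25, 45, 26, 46, 12546,
   67, 56, 27, 12567, 16431027, 12013465, 12013467, 56, 67, 47, 14567, 16201347, 14310267,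
   14310265, 26, 57, 27, 56, 12657, 12013456, 15431027, 12013457, 15431026, 46, 56, 47, 57, 14657,
   14310257, 15201347, 14310256, 15201346]

set_option maxRecDepth 100000 in
lemma win13 : Win 13 [] := by
  refine run_sound 13 strategy [] [] [] [] ⟨by simp [mem], by simp [mem]⟩ ?_
  decide +kernel

/-! ### Painter's strategy: red unless this closes a red `C₄` -/

def code (a b : ℕ) : ℕ := bif Nat.ble a b then 7 * a + b else 7 * b + a

def ins (x : ℕ) (l : List ℕ) : List ℕ := bif l.any (Nat.beq x) then l else x :: l

/-- Is it possible to choose red paths of length three joining `i` and `i + 1`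
for all `i` in the list, using at most six red edges (including those in `l`)? -/
def srch : List ℕ → List ℕ → Bool
  | [], _ => true
  | i :: is, l =>
    (List.range 7).any fun a =>
      (!(Nat.beq a i) && !(Nat.beq a (i + 1))) &&
      (List.range 7).any fun b =>
        (!(Nat.beq b i) && !(Nat.beq b (i + 1)) && !(Nat.beq a b)) &&
        (Nat.ble (ins (code i a) (ins (code a b) (ins (code b (i + 1)) l))).length 6 &&
         srch is (ins (code i a) (ins (code a b) (ins (code b (i + 1)) l))))

lemma srch_false : srch [0, 1, 2, 3, 4, 5] [] = false := by decide +kernel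

lemma ins_spec {x : ℕ} {l : List ℕ} {E : Finset ℕ} (hx : x ∈ E)
    (hl : l.Nodup ∧ ∀ y ∈ l, y ∈ E) : (ins x l).Nodup ∧ ∀ y ∈ ins x l, y ∈ E := by
  unfold ins
  cases h : l.any (Nat.beq x) with
  | true => simpa using hl
  | false =>
    have hx' : x ∉ l := by
      intro hm
      rw [List.any_eq_false] at h
      exact h x hm (by simp)
    simp only [cond_false, List.nodup_cons, List.mem_cons, forall_eq_or_imp]
    exact ⟨⟨hx', hl.1⟩, hx, hl.2⟩

lemma srch_complete (E : Finset ℕ) (hE : E.card ≤ 6) : ∀ (is l : List ℕ),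
    (l.Nodup ∧ ∀ y ∈ l, y ∈ E) →
    (∀ i ∈ is, ∃ a b, a < 7 ∧ b < 7 ∧ a ≠ i ∧ a ≠ i + 1 ∧ b ≠ i ∧ b ≠ i + 1 ∧ a ≠ b ∧
      code i a ∈ E ∧ code a b ∈ E ∧ code b (i + 1) ∈ E) → srch is l = true := by
  intro is
  induction is with
  | nil => intros; rfl
  | cons i is ih =>
    intro l hl his
    obtain ⟨a, b, ha, hb, h1, h2, h3, h4, h5, e1, e2, e3⟩ := his i (by simp)
    have hl' := ins_spec e1 (ins_spec e2 (ins_spec e3 hl))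
    have hlen : (ins (code i a) (ins (code a b) (ins (code b (i + 1)) l))).length ≤ 6 := by
      rw [← List.toFinset_card_of_nodup hl'.1]
      refine (Finset.card_le_card ?_).trans hE
      intro y hy
      exact hl'.2 y (List.mem_toFinset.1 hy)
    rw [srch, List.any_eq_true]
    refine ⟨a, List.mem_range.2 ha, ?_⟩
    rw [Bool.and_eq_true]
    refine ⟨by rw [beq_false h1, beq_false h2]; rfl, ?_⟩
    rw [List.any_eq_true]
    refine ⟨b, List.mem_range.2 hb, ?_⟩
    refine Bool.and_eq_true_iff.2 ⟨by rw [beq_false h3, beq_false h4, beq_false h5]; rfl,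
      Bool.and_eq_true_iff.2 ⟨Nat.ble_eq_true_of_le hlen,
        ih _ hl' fun j hj => his j (List.mem_cons_of_mem _ hj)⟩⟩

lemma code_comm (a b : ℕ) : code a b = code b a := by
  unfold code
  rcases lt_trichotomy a b with h | rfl | h
  · have h1 : Nat.ble a b = true := Nat.ble_eq_true_of_le h.le
    have h2 : Nat.ble b a = false := by
      rw [Bool.eq_false_iff]; intro h'; have := Nat.le_of_ble_eq_true h'; omega
    simp [h1, h2]
  · rfl
  · have h1 : Nat.ble b a = true := Nat.ble_eq_true_of_le h.le
    have h2 : Nat.ble a b = false := by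
      rw [Bool.eq_false_iff]; intro h'; have := Nat.le_of_ble_eq_true h'; omega
    simp [h1, h2]

/-- Endpoints `u`, `v` are joined by a path of three edges. -/
def Three (G : SimpleGraph ℕ) (u v : ℕ) : Prop :=
  ∃ a b, G.Adj u a ∧ G.Adj a b ∧ G.Adj b v ∧ a ≠ v ∧ b ≠ u

lemma Three.symm {G : SimpleGraph ℕ} {u v : ℕ} (h : Three G u v) : Three G v u := by
  obtain ⟨a, b, h1, h2, h3, h4, h5⟩ := h
  exact ⟨b, a, h3.symm, h2.symm, h1.symm, h5, h4⟩

lemma core (G : SimpleGraph ℕ) (E : Finset Edge) (hGE : G.edgeSet ⊆ E) (hE : E.card ≤ 6)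
    (v : Fin 7 → ℕ) (hv : Function.Injective v)
    (h3 : ∀ i j : Fin 7, i.val + 1 = j.val → Three G (v i) (v j)) : False := by
  classical
  have hreach3 : ∀ x y, Three G x y → G.Reachable x y := by
    rintro x y ⟨a, b, h1, h2, h3, -, -⟩
    exact h1.reachable.trans (h2.reachable.trans h3.reachable)
  have hreach : ∀ n (hn : n < 7), G.Reachable (v 0) (v ⟨n, hn⟩) := by
    intro n
    induction n with
    | zero => intro _; exact SimpleGraph.Reachable.refl _
    | succ n ih =>
      intro hn
      exact (ih (by omega)).trans (hreach3 _ _ (h3 ⟨n, by omega⟩ ⟨n + 1, hn⟩ rfl))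
  set C := G.connectedComponentMk (v 0) with hC
  have hmemC : ∀ x, x ∈ C.supp ↔ G.Reachable (v 0) x := by
    intro x
    rw [SimpleGraph.ConnectedComponent.mem_supp_iff, hC, SimpleGraph.ConnectedComponent.eq]
    exact ⟨fun h => h.symm, fun h => h.symm⟩
  have hfin : C.supp.Finite := by
    refine ((Set.finite_singleton (v 0)).union
      (E.finite_toSet.biUnion (t := fun e => {x | x ∈ e}) ?_)).subset ?_
    · intro e _
      induction e using Sym2.ind with
      | _ x y =>
        refine (Set.toFinite {x, y}).subset ?_
        intro z hz
        simpa using hz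
    · intro x hx
      rw [hmemC] at hx
      by_cases hx0 : x = v 0
      · exact Or.inl hx0
      · right
        obtain ⟨w⟩ := hx.symm
        cases w with
        | nil => exact absurd rfl hx0
        | cons hadj _ =>
          exact Set.mem_biUnion (hGE ((SimpleGraph.mem_edgeSet G).2 hadj)) (by simp)
  have hcard : C.supp.ncard ≤ 7 := by
    have h1 := C.connected_toSimpleGraph.card_vert_le_card_edgeSet_add_one
    have h2 : Nat.card C.toSimpleGraph.edgeSet ≤ 6 := by
      have hf : ∀ e : C.toSimpleGraph.edgeSet, e.1.map (Subtype.val) ∈ E := by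
        rintro ⟨e, he⟩
        induction e using Sym2.ind with
        | _ x y =>
          refine hGE ?_
          exact he
      have := Nat.card_le_card_of_injective
        (fun e : C.toSimpleGraph.edgeSet => (⟨e.1.map Subtype.val, hf e⟩ : E)) (by
          intro e e' hee
          have h := congrArg Subtype.val hee
          exact Subtype.ext (Sym2.map.injective Subtype.val_injective h))
      simp at this
      simpa using this.trans hE
    have h3 : Nat.card C.supp = C.supp.ncard := rfl
    have h4 : Nat.card C.supp ≤ Nat.card C.toSimpleGraph.edgeSet + 1 := h1
    omega
  have hsub : Set.range v ⊆ C.supp := by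
    rintro _ ⟨i, rfl⟩
    exact (hmemC _).2 (hreach i.1 i.2)
  have hrange : Set.range v = C.supp := by
    refine Set.eq_of_subset_of_ncard_le hsub ?_ hfin
    rw [← Set.image_univ, Set.ncard_image_of_injective _ hv, Set.ncard_univ]
    simpa using hcard
  let g : ℕ → Fin 7 := Function.invFun v
  have hg : ∀ i, g (v i) = i := Function.leftInverse_invFun hv
  let φ : Edge → ℕ := Sym2.lift ⟨fun x y => code (g x) (g y), fun x y => code_comm _ _⟩
  have hφ : ∀ i j, G.Adj (v i) (v j) → code i j ∈ E.image φ := by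
    intro i j hij
    refine Finset.mem_image.2 ⟨s(v i, v j), hGE hij, ?_⟩
    simp [φ, hg]
  have hs := srch_complete (E.image φ) (Finset.card_image_le.trans hE) [0, 1, 2, 3, 4, 5] []
    (by simp) (by
      intro i hi
      have hi6 : i < 6 := by
        simp at hi
        omega
      obtain ⟨a, b, h1, h2, h3', h4, h5⟩ := h3 ⟨i, by omega⟩ ⟨i + 1, by omega⟩ rfl
      have ha : a ∈ C.supp := (hmemC _).2 ((hreach i (by omega)).trans h1.reachable)
      have hb : b ∈ C.supp := (hmemC _).2
        (((hreach i (by omega)).trans h1.reachable).trans h2.reachable)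
      rw [← hrange] at ha hb
      obtain ⟨a, rfl⟩ := ha
      obtain ⟨b, rfl⟩ := hb
      have ne : ∀ x y : Fin 7, v x ≠ v y → x.val ≠ y.val := fun x y h h' =>
        h (congrArg v (Fin.ext h'))
      exact ⟨a, b, a.2, b.2, ne _ _ h1.ne', ne a ⟨i + 1, by omega⟩ h4, ne b ⟨i, by omega⟩ h5,
        ne b ⟨i + 1, by omega⟩ h3'.ne, ne _ _ h2.ne, hφ ⟨i, by omega⟩ a h1, hφ a b h2,
        hφ b ⟨i + 1, by omega⟩ h3'⟩)
  rw [srch_false] at hs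
  exact Bool.noConfusion hs

/-- If adding the edge `uv` creates a `C₄`, its ends are joined by a path of three edges. -/
lemma three_of_copy (h : History) (u v : ℕ) (hno : ¬ HasCopy C4 (redGraph h))
    (hyes : HasCopy C4 (redGraph (h ++ [(s(u, v), true)]))) : Three (redGraph h) u v := by
  obtain ⟨f, hf⟩ := hyes
  have hadj : ∀ x y, (redGraph (h ++ [(s(u, v), true)])).Adj x y →
      (redGraph h).Adj x y ∨ (s(x, y) : Edge) = s(u, v) := by
    intro x y hxy
    obtain ⟨h1, h2⟩ := (SimpleGraph.fromEdgeSet_adj _).1 hxy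
    have h1' : (s(x, y), true) ∈ h ++ [(s(u, v), true)] := h1
    rw [List.mem_append, List.mem_singleton, Prod.mk.injEq] at h1'
    rcases h1' with h1' | h1'
    · exact Or.inl ((SimpleGraph.fromEdgeSet_adj _).2 ⟨h1', h2⟩)
    · exact Or.inr h1'.1
  have hstep : ∀ i : Fin 4, C4.Adj i (i + 1) := by decide
  have hc : ∀ i j : Fin 4, C4.Adj i j → j = i + 1 ∨ i = j + 1 := by decide
  by_cases hall : ∀ i : Fin 4, (redGraph h).Adj (f i) (f (i + 1))
  · refine absurd ⟨⟨f, ?_⟩, hf⟩ hno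
    intro i j hij
    rcases hc i j hij with rfl | rfl
    · exact hall i
    · exact (hall j).symm
  · push Not at hall
    obtain ⟨i, hi⟩ := hall
    have he : (s(f i, f (i + 1)) : Edge) = s(u, v) :=
      (hadj _ _ (f.map_rel (hstep i))).resolve_left hi
    have hother : ∀ j : Fin 4, j ≠ i → (redGraph h).Adj (f j) (f (j + 1)) := by
      intro j hj
      refine (hadj _ _ (f.map_rel (hstep j))).resolve_right fun hj' => ?_
      replace hj' := Sym2.eq_iff.1 (hj'.trans he.symm)
      have hd : ∀ i j : Fin 4, j ≠ i → ¬ ((j = i ∧ j + 1 = i + 1) ∨ (j = i + 1 ∧ j + 1 = i)) := by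
        decide
      refine hd i j hj ?_
      rcases hj' with ⟨p, q⟩ | ⟨p, q⟩
      · exact Or.inl ⟨hf p, hf q⟩
      · exact Or.inr ⟨hf p, hf q⟩
    have hthree : Three (redGraph h) (f (i + 1)) (f i) := by
      have n1 : ∀ i : Fin 4, i + 1 ≠ i ∧ i + 1 + 1 ≠ i ∧ i + 1 + 1 + 1 ≠ i ∧
          i + 1 + 1 + 1 + 1 = i ∧ i + 1 + 1 + 1 ≠ i + 1 := by decide
      obtain ⟨d1, d2, d3, d4, d5⟩ := n1 i
      have a3 := hother _ d3
      rw [d4] at a3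
      exact ⟨f (i + 1 + 1), f (i + 1 + 1 + 1), hother _ d1, hother _ d2, a3,
        fun h' => d2 (hf h'), fun h' => d5 (hf h')⟩
    rcases Sym2.eq_iff.1 he with ⟨p, q⟩ | ⟨p, q⟩
    · rw [p, q] at hthree
      exact hthree.symm
    · rw [p, q] at hthree
      exact hthree

lemma Three.mono {G H : SimpleGraph ℕ} (hle : G ≤ H) {u v : ℕ} (h : Three G u v) :
    Three H u v := by
  obtain ⟨a, b, h1, h2, h3, h4, h5⟩ := h
  exact ⟨a, b, hle h1, hle h2, hle h3, h4, h5⟩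

lemma redGraph_append_le (h : History) (x : Edge × Bool) : redGraph h ≤ redGraph (h ++ [x]) :=
  SimpleGraph.fromEdgeSet_mono fun _ he => List.mem_append_left _ he

open Classical in
/-- Painter's strategy. -/
noncomputable def greedy : PainterStrat := fun h e =>
  decide (¬ HasCopy C4 (redGraph (h ++ [(e, true)])))

lemma greedy_inv (B : BuilderStrat) (t : ℕ) :
    ¬ HasCopy C4 (redGraph (gamePlay B greedy t)) ∧
    ∀ u v, (s(u, v), false) ∈ gamePlay B greedy t → Three (redGraph (gamePlay B greedy t)) u v := by
  induction t with
  | zero =>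
    refine ⟨?_, fun u v h => by simp [gamePlay] at h⟩
    rintro ⟨f, hf⟩
    have := f.map_rel (show C4.Adj 0 1 by decide)
    simp [gamePlay, redGraph, redSet] at this
  | succ t ih =>
    obtain ⟨ih1, ih2⟩ := ih
    have hgp : gamePlay B greedy (t + 1) = gamePlay B greedy t ++
      [(B (gamePlay B greedy t), greedy (gamePlay B greedy t) (B (gamePlay B greedy t)))] := rfl
    rw [hgp]
    generalize gamePlay B greedy t = h at *
    generalize B h = e at *
    by_cases hc : HasCopy C4 (redGraph (h ++ [(e, true)]))
    · have hg : greedy h e = false := by simp [greedy, hc]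
      rw [hg]
      have hred : redGraph (h ++ [(e, false)]) = redGraph h := by
        unfold redGraph
        congr 1
        ext x
        simp [redSet]
      rw [hred]
      refine ⟨ih1, fun u v huv => ?_⟩
      rw [List.mem_append, List.mem_singleton, Prod.mk.injEq] at huv
      rcases huv with huv | ⟨huv, -⟩
      · exact ih2 u v huv
      · subst huv
        exact three_of_copy h u v ih1 hc
    · have hg : greedy h e = true := by simp [greedy, hc]
      rw [hg]
      refine ⟨hc, fun u v huv => ?_⟩
      rw [List.mem_append, List.mem_singleton, Prod.mk.injEq] at huv
      rcases huv with huv | ⟨-, huv⟩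
      · exact (ih2 u v huv).mono (redGraph_append_le _ _)
      · exact Bool.noConfusion huv

def colourEdges (h : History) (c : Bool) : Finset Edge :=
  ((h.filter fun x => x.2 == c).map Prod.fst).toFinset

lemma mem_colourEdges (h : History) (c : Bool) (e : Edge) :
    e ∈ colourEdges h c ↔ (e, c) ∈ h := by
  simp [colourEdges]

lemma card_colourEdges (h : History) :
    (colourEdges h true).card + (colourEdges h false).card ≤ h.length := by
  have h1 : ∀ c, (colourEdges h c).card ≤ (h.filter fun x => x.2 == c).length := fun c => by
    simpa [colourEdges] using List.toFinset_card_le ((h.filter fun x => x.2 == c).map Prod.fst)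
  have h2 : (h.filter fun x => x.2 == true).length + (h.filter fun x => x.2 == false).length
      = h.length := by
    clear h1
    induction h with
    | nil => rfl
    | cons x l ih =>
      obtain ⟨e, c⟩ := x
      cases c <;> simp at ih ⊢ <;> omega
  have := h1 true
  have := h1 false
  omega

lemma greedy_no_P7 (B : BuilderStrat) :
    ¬ HasCopy P7 (blueGraph (gamePlay B greedy 12)) := by
  rintro ⟨f, hf⟩
  obtain ⟨-, hinv⟩ := greedy_inv B 12
  have hlen := gamePlay_length B greedy 12
  generalize gamePlay B greedy 12 = h at *
  have hblue : ∀ i j : Fin 7, i.val + 1 = j.val → (s(f i, f j), false) ∈ h := by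
    intro i j hij
    exact ((SimpleGraph.fromEdgeSet_adj _).1
      (f.map_rel (SimpleGraph.pathGraph_adj.2 (Or.inl hij)))).1
  have hb6 : 6 ≤ (colourEdges h false).card := by
    have hinj : Function.Injective (fun i : Fin 6 => (s(f i.castSucc, f i.succ) : Edge)) := by
      intro i j hij
      rcases Sym2.eq_iff.1 hij with ⟨p, -⟩ | ⟨p, q⟩
      · exact Fin.castSucc_injective _ (hf p)
      · have p' := congrArg Fin.val (hf p)
        have q' := congrArg Fin.val (hf q)
        simp at p' q'
        omega
    have := Finset.card_le_card_of_injOn (s := Finset.univ) (t := colourEdges h false)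
      (fun i : Fin 6 => (s(f i.castSucc, f i.succ) : Edge))
      (fun i _ => (mem_colourEdges _ _ _).2 (hblue _ _ (by simp))) hinj.injOn
    simpa using this
  have hsum := card_colourEdges h
  refine core (redGraph h) (colourEdges h true) ?_ (by omega) f hf
    fun i j hij => hinv _ _ (hblue i j hij)
  intro e he
  rw [redGraph, SimpleGraph.edgeSet_fromEdgeSet] at he
  exact (mem_colourEdges _ _ _).2 he.1

/-- `r̃(C₄, P₇) = 13`: Builder can force a red `C₄` or a blue `P₇` within `13` rounds,
while for every Builder strategy some Painter strategy avoids both for `12` rounds. -/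
theorem onlineRamsey_C4_P7_eq :
    BuilderForces (SimpleGraph.cycleGraph 4) (SimpleGraph.pathGraph 7) 13 ∧
    ∀ B : BuilderStrat, BuilderLegal B 12 →
      ∃ P : PainterStrat,
        ¬ HasCopy (SimpleGraph.cycleGraph 4) (redGraph (gamePlay B P 12)) ∧
        ¬ HasCopy (SimpleGraph.pathGraph 7) (blueGraph (gamePlay B P 12)) := by
  exact ⟨forces_of_win 13 win13, fun B _ => ⟨greedy, (greedy_inv B 12).1, greedy_no_P7 B⟩⟩

end OnlineRamsey
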